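/- Let f: Ω → ℝ be α-Hölder with λ > 0 and strictly positive α-Hölder h satisfying L_f h = λ h; set f̄ = f + log h − log(h∘σ) − log λ, and let μ_f̄ be the unique Borel probability measure with L_{f̄}* μ_f̄ = μ_f̄ (it is shift-invariant and ergodic). Then for a shift-invariant Borel probability measure μ on Ω, lim_{n→∞} (1/n) H_{Λ_n}(μ | μ_f̄) = 0 if and only if L_{f̄}* μ = μ, i.e., if and only if μ = μ_f̄. -/

import Mathlib

open MeasureTheory Filter
open scoped Classical

noncomputable section

namespace Paper

variable {A : Type*} [MetricSpace A] [CompactSpace A] [MeasurableSpace A] [BorelSpace A]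

/-- The left shift `σ` on `Ω = Aᴺ`. -/
def shift (x : ℕ → A) : ℕ → A := fun n => x (n + 1)

/-- Prepend a symbol: `cons a x = (a, x₀, x₁, …)`. -/
def cons (a : A) (x : ℕ → A) : ℕ → A := fun n =>
  match n with
  | 0 => a
  | n + 1 => x n

/-- The metric `d_Ω` on `Ω`. -/
def dOmega (x y : ℕ → A) : ℝ :=
  ∑' n : ℕ, (1 / 2 : ℝ) ^ (n + 1) * (dist (x n) (y n) / (1 + dist (x n) (y n)))

/-- `f` is `α`-Hölder with respect to `d_Ω`. -/
def IsHolder (α : ℝ) (f : (ℕ → A) → ℝ) : Prop :=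
  ∃ C : ℝ, 0 ≤ C ∧ ∀ x y, |f x - f y| ≤ C * dOmega x y ^ α

/-- The Ruelle transfer operator with a priori measure `p`. -/
def ruelle (p : Measure A) (f φ : (ℕ → A) → ℝ) : (ℕ → A) → ℝ :=
  fun x => ∫ a, Real.exp (f (cons a x)) * φ (cons a x) ∂p

/-- The normalized potential `f̄ = f + log h - log (h ∘ σ) - log λ`. -/
def fbar (f h : (ℕ → A) → ℝ) (lam : ℝ) : (ℕ → A) → ℝ :=
  fun x => f x + Real.log (h x) - Real.log (h (shift x)) - Real.log lam

/-- Projection on the first `n` coordinates. -/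
def proj (n : ℕ) (x : ℕ → A) : Fin n → A := fun i => x i

/-- Relative entropy `H(μ|ν)` of two measures, with value `+∞` unless
`μ ≪ ν` and the entropy integral is finite. -/
def relEnt {X : Type*} [MeasurableSpace X] (μ ν : Measure X) : EReal :=
  if μ ≪ ν ∧ Integrable (fun x => Real.log (μ.rnDeriv ν x).toReal) μ then
    ((∫ x, Real.log (μ.rnDeriv ν x).toReal ∂μ : ℝ) : EReal)
  else ⊤

/-- Relative entropy `H_{Λ_n}(μ|ν)` on the σ-algebra of the first `n` coordinates. -/
def relEntN (n : ℕ) (μ ν : Measure (ℕ → A)) : EReal :=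
  relEnt (μ.map (proj n)) (ν.map (proj n))

/-- The entropy `H_{Λ_n}(μ) = -H_{Λ_n}(μ | pᴺ)` relative to the a priori measure `p`. -/
def finEnt (p : Measure A) (μ : Measure (ℕ → A)) (n : ℕ) : EReal :=
  - relEnt (μ.map (proj n)) (Measure.pi fun _ : Fin n => p)

/-- The specific entropy `h^s(μ) = lim_n H_{Λ_n}(μ)/n` (defined as a `limsup`,
which coincides with the limit whenever the latter exists). -/
def specEnt (p : Measure A) (μ : Measure (ℕ → A)) : EReal :=
  Filter.atTop.limsup fun n : ℕ => ((n : ℝ)⁻¹ : EReal) * finEnt p μ n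

/-- Birkhoff sum `S_n(f)`. -/
def birkhoff (n : ℕ) (f : (ℕ → A) → ℝ) (x : ℕ → A) : ℝ :=
  ∑ i ∈ Finset.range n, f (shift^[i] x)

/-- The configuration `x_{Λ_n} y_{Λ_n^c}`. -/
def concatAt (n : ℕ) (x y : ℕ → A) : ℕ → A := fun i => if i < n then x i else y i

/-- Concatenation of a finite word with a configuration. -/
def wordCons (n : ℕ) (a : Fin n → A) (x : ℕ → A) : ℕ → A :=
  fun i => if h : i < n then a ⟨i, h⟩ else x (i - n)

lemma continuous_shift {X : Type*} [TopologicalSpace X] : Continuous (shift : (ℕ → X) → ℕ → X) :=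
  continuous_pi fun n => continuous_apply (n + 1)

lemma continuous_cons {X : Type*} [TopologicalSpace X] :
    Continuous fun q : (ℕ → X) × X => cons q.2 q.1 := by
  refine continuous_pi fun n => ?_
  cases n with
  | zero => exact continuous_snd
  | succ n => exact (continuous_apply n).comp continuous_fst

lemma shift_cons {X : Type*} (a : X) (x : ℕ → X) : shift (cons a x) = x := rfl

lemma shift_iterate_apply {X : Type*} (i n : ℕ) (x : ℕ → X) : shift^[i] x n = x (n + i) := by
  induction i generalizing x with
  | zero => rfl
  | succ i ih =>
    rw [Function.iterate_succ_apply, ih]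
    exact congrArg x (by omega)

lemma continuous_proj {X : Type*} [TopologicalSpace X] (n : ℕ) :
    Continuous (proj n : (ℕ → X) → Fin n → X) :=
  continuous_pi fun i => continuous_apply (i : ℕ)

lemma continuous_wordCons {X : Type*} [TopologicalSpace X] (n : ℕ) (x : ℕ → X) :
    Continuous fun a : Fin n → X => wordCons n a x := by
  refine continuous_pi fun i => ?_
  by_cases h : i < n
  · simpa [wordCons, h] using continuous_apply (⟨i, h⟩ : Fin n)
  · simpa [wordCons, h] using continuous_const

lemma wordCons_proj_apply {X : Type*} {n i : ℕ} (h : i < n) (x y : ℕ → X) :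
    wordCons n (proj n x) y i = x i := by
  simp [wordCons, proj, h]

lemma continuous_dOmega {X : Type*} [MetricSpace X] :
    Continuous fun q : (ℕ → X) × (ℕ → X) => dOmega q.1 q.2 := by
  refine continuous_tsum (u := fun n : ℕ => (1 / 2 : ℝ) ^ (n + 1)) (fun n => ?_) ?_ fun n q => ?_
  · have hd : Continuous fun q : (ℕ → X) × (ℕ → X) => dist (q.1 n) (q.2 n) := by fun_prop
    exact continuous_const.mul (hd.div (continuous_const.add hd) fun q => by positivity)
  · exact (summable_nat_add_iff 1).2 summable_geometric_two
  · have hd : 0 ≤ dist (q.1 n) (q.2 n) := dist_nonneg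
    rw [Real.norm_of_nonneg (by positivity)]
    refine mul_le_of_le_one_right (by positivity) ?_
    exact div_le_one_of_le₀ (by linarith) (by positivity)

lemma dOmega_self {X : Type*} [MetricSpace X] (x : ℕ → X) : dOmega x x = 0 := by simp [dOmega]

lemma IsHolder.continuous {X : Type*} [MetricSpace X] {α : ℝ} (hα : 0 < α)
    {f : (ℕ → X) → ℝ} (hf : IsHolder α f) :
    Continuous f := by
  obtain ⟨C, -, hC⟩ := hf
  refine continuous_iff_continuousAt.2 fun y => ?_
  have hd : Continuous fun x : ℕ → X => C * dOmega x y ^ α :=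
    continuous_const.mul
      ((continuous_dOmega.comp (continuous_id.prodMk continuous_const)).rpow_const
        fun _ => Or.inr hα.le)
  have hlim : Tendsto (fun x : ℕ → X => C * dOmega x y ^ α) (nhds y) (nhds 0) := by
    simpa [dOmega_self, Real.zero_rpow hα.ne'] using hd.tendsto y
  exact tendsto_iff_dist_tendsto_zero.2
    (squeeze_zero (fun _ => dist_nonneg) (fun x => hC x y) hlim)

lemma continuous_fbar {X : Type*} [TopologicalSpace X]
    {f h : (ℕ → X) → ℝ} (hf : Continuous f) (hh : Continuous h)
    (hpos : ∀ x, 0 < h x) (lam : ℝ) : Continuous (fbar f h lam) := by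
  have hlog : Continuous fun x => Real.log (h x) := hh.log fun x => (hpos x).ne'
  exact ((hf.add hlog).sub (hlog.comp continuous_shift)).sub continuous_const

lemma continuous_ruelle (p : Measure A) [IsFiniteMeasure p] {g φ : (ℕ → A) → ℝ}
    (hg : Continuous g) (hφ : Continuous φ) : Continuous (ruelle p g φ) := by
  have hc : Continuous (Function.uncurry fun (x : ℕ → A) (a : A) =>
      Real.exp (g (cons a x)) * φ (cons a x)) :=
    (hg.comp continuous_cons).rexp.mul (hφ.comp continuous_cons)
  have := continuous_parametric_integral_of_continuous (μ := p) hc isCompact_univ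
  rwa [Measure.restrict_univ] at this

lemma integrable_ruelle (p : Measure A) [IsFiniteMeasure p] {g φ : (ℕ → A) → ℝ}
    (hg : Continuous g) (hφ : Continuous φ) (x : ℕ → A) :
    Integrable (fun a => Real.exp (g (cons a x)) * φ (cons a x)) p := by
  have hc : Continuous fun a : A => cons a x :=
    continuous_cons.comp (continuous_const.prodMk continuous_id)
  exact ((hg.comp hc).rexp.mul (hφ.comp hc)).integrable_of_hasCompactSupport
    (HasCompactSupport.of_compactSpace _)

/-- The operator of the normalized potential preserves the constant function `1`. -/
lemma ruelle_fbar_one {X : Type*} [MeasurableSpace X] {p : Measure X} {f h : (ℕ → X) → ℝ}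
    {lam : ℝ} (hlam : 0 < lam)
    (hpos : ∀ x, 0 < h x) (heig : ∀ x, ruelle p f h x = lam * h x) (x : ℕ → X) :
    ruelle p (fbar f h lam) (fun _ => 1) x = 1 := by
  have hpt : ∀ a, Real.exp (fbar f h lam (cons a x)) * 1
      = Real.exp (f (cons a x)) * h (cons a x) / (lam * h x) := by
    intro a
    rw [fbar, Real.exp_sub, Real.exp_sub, Real.exp_add, Real.exp_log (hpos _),
      Real.exp_log (hpos _), Real.exp_log hlam, shift_cons, mul_one, div_div, mul_comm (h x)]
  have he := heig x
  simp only [ruelle] at he ⊢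
  simp_rw [hpt]
  rw [integral_div, he, div_self (mul_pos hlam (hpos x)).ne']

lemma ruelle_mul_comp_shift {X : Type*} [MeasurableSpace X] (p : Measure X)
    (g φ ψ : (ℕ → X) → ℝ) (x : ℕ → X) :
    ruelle p g (fun y => φ y * ψ (shift y)) x = ruelle p g φ x * ψ x := by
  simp only [ruelle, shift_cons, ← mul_assoc]
  exact integral_mul_const _ _

lemma ruelle_exp_pos {p : Measure A} [IsProbabilityMeasure p] {g φ : (ℕ → A) → ℝ}
    (hg : Continuous g) (hφ : Continuous φ) (x : ℕ → A) :
    0 < ruelle p g (fun y => Real.exp (φ y)) x := by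
  have hint := integrable_ruelle p hg hφ.rexp x
  simp only [ruelle, ← Real.exp_add] at hint ⊢
  exact integral_exp_pos hint

lemma birkhoff_succ {X : Type*} (n : ℕ) (u : (ℕ → X) → ℝ) (x : ℕ → X) :
    birkhoff (n + 1) u x = u x + birkhoff n u (shift x) := by
  simp [birkhoff, Finset.sum_range_succ', add_comm]

lemma continuous_birkhoff {X : Type*} [TopologicalSpace X]
    {u : (ℕ → X) → ℝ} (hu : Continuous u) (n : ℕ) :
    Continuous (birkhoff n u) :=
  continuous_finsetSum _ fun i _ => hu.comp (continuous_shift.iterate i)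

/-- If `L_g (e^u) = 1`, then `e^{S_n u}` has integral `1` for every fixed point of `L_g*`. -/
lemma integral_exp_birkhoff {X : Type*} [TopologicalSpace X] [MeasurableSpace X]
    {p : Measure X} {g u : (ℕ → X) → ℝ} (hu : Continuous u)
    (hone : ∀ x, ruelle p g (fun y => Real.exp (u y)) x = 1)
    (ν : Measure (ℕ → X)) [IsProbabilityMeasure ν]
    (hfix : ∀ φ : (ℕ → X) → ℝ, Continuous φ → ∫ x, ruelle p g φ x ∂ν = ∫ x, φ x ∂ν) (n : ℕ) :
    ∫ x, Real.exp (birkhoff n u x) ∂ν = 1 := by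
  induction n with
  | zero => simp [birkhoff]
  | succ n ih =>
    rw [← hfix _ (continuous_birkhoff hu (n + 1)).rexp, ← ih]
    refine integral_congr_ae (Eventually.of_forall fun x => ?_)
    have hmul := ruelle_mul_comp_shift p g (fun y => Real.exp (u y))
      (fun y => Real.exp (birkhoff n u y)) x
    simpa only [birkhoff_succ, Real.exp_add, hone, one_mul] using hmul

lemma integral_comp_shift {μ : Measure (ℕ → A)} (hinv : μ.map shift = μ) {u : (ℕ → A) → ℝ}
    (hu : Continuous u) : ∫ x, u (shift x) ∂μ = ∫ x, u x ∂μ := by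
  conv_rhs => rw [← hinv]
  exact (integral_map continuous_shift.measurable.aemeasurable
    hu.measurable.aestronglyMeasurable).symm

lemma integrable_of_continuous {X : Type*} [TopologicalSpace X] [CompactSpace X]
    [MeasurableSpace X] [OpensMeasurableSpace X] {u : X → ℝ} (hu : Continuous u) (μ : Measure X)
    [IsFiniteMeasure μ] : Integrable u μ :=
  hu.integrable_of_hasCompactSupport (HasCompactSupport.of_compactSpace _)

lemma integral_birkhoff {μ : Measure (ℕ → A)} [IsProbabilityMeasure μ] (hinv : μ.map shift = μ)
    {u : (ℕ → A) → ℝ} (hu : Continuous u) (n : ℕ) :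
    ∫ x, birkhoff n u x ∂μ = n * ∫ x, u x ∂μ := by
  induction n with
  | zero => simp [birkhoff]
  | succ n ih =>
    have hn := continuous_birkhoff hu n
    have hns : Continuous fun x => birkhoff n u (shift x) := hn.comp continuous_shift
    simp_rw [birkhoff_succ]
    rw [integral_add (integrable_of_continuous hu μ)
      (integrable_of_continuous hns μ),
      integral_comp_shift hinv hn, ih]
    push_cast
    ring

/-- A continuous function on `Ω` depends on finitely many coordinates up to a uniform error. -/
lemma exists_dependsOn_approx {X : Type*} [MetricSpace X] [CompactSpace X]
    {u : (ℕ → X) → ℝ} (hu : Continuous u) {ε : ℝ} (hε : 0 < ε) :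
    ∃ k : ℕ, ∀ x y : ℕ → X, (∀ i < k, x i = y i) → |u x - u y| < ε := by
  have huc := CompactSpace.uniformContinuous_of_continuous hu
  have hmem := huc (Metric.dist_mem_uniformity hε)
  rw [Filter.mem_map, Pi.uniformity, Filter.mem_iInf] at hmem
  obtain ⟨I, hI, V, hV, hVeq⟩ := hmem
  obtain ⟨k, hk⟩ := hI.bddAbove
  refine ⟨k + 1, fun x y hxy => ?_⟩
  have hin : (x, y) ∈ ⋂ i, V i := by
    refine Set.mem_iInter.2 fun i => ?_
    obtain ⟨W, hW, hWV⟩ := hV i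
    refine hWV ?_
    have hi : x i = y i := hxy i (Nat.lt_succ_of_le (hk i.2))
    simpa [hi] using refl_mem_uniformity hW
  rw [← hVeq] at hin
  simpa [Real.dist_eq] using hin

/-- The Donsker–Varadhan lower bound for the relative entropy. -/
lemma integral_sub_log_le_relEnt {X : Type*} [MeasurableSpace X] {μ ν : Measure X}
    [IsProbabilityMeasure μ] [IsProbabilityMeasure ν] {ψ : X → ℝ} (hμ : Integrable ψ μ)
    (hν : Integrable (fun x => Real.exp (ψ x)) ν) :
    ((∫ x, ψ x ∂μ - Real.log (∫ x, Real.exp (ψ x) ∂ν) : ℝ) : EReal) ≤ relEnt μ ν := by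
  unfold relEnt
  split_ifs with hc
  · obtain ⟨hac, hint⟩ := hc
    have := isProbabilityMeasure_tilted hν
    have hnn := InformationTheory.integral_llr_add_sub_measure_univ_nonneg
      (hac.trans (absolutelyContinuous_tilted hν)) (integrable_llr_tilted_right hac hμ hint hν)
    rw [integral_llr_tilted_right hac hμ hν hint] at hnn
    simp only [probReal_univ, llr] at hnn
    exact EReal.coe_le_coe_iff.2 (by linarith)
  · exact le_top

lemma relEnt_self {X : Type*} [MeasurableSpace X] (μ : Measure X) [SigmaFinite μ] :
    relEnt μ μ = 0 := by
  have hae : (fun x => Real.log (μ.rnDeriv μ x).toReal) =ᵐ[μ] fun _ => 0 := by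
    filter_upwards [μ.rnDeriv_self] with x hx
    simp [hx]
  rw [relEnt, if_pos ⟨Measure.AbsolutelyContinuous.rfl,
    (integrable_congr hae).2 (integrable_zero _ _ _)⟩, integral_congr_ae hae]
  simp

lemma abs_birkhoff_sub_le {X : Type*} {u : (ℕ → X) → ℝ} {ε : ℝ} {k : ℕ}
    (hk : ∀ x y : ℕ → X, (∀ i < k, x i = y i) → |u x - u y| < ε) (n : ℕ) (x y : ℕ → X)
    (hxy : ∀ i < n + k, x i = y i) : |birkhoff n u x - birkhoff n u y| ≤ n * ε := by
  rw [birkhoff, birkhoff, ← Finset.sum_sub_distrib]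
  refine (Finset.abs_sum_le_sum_abs _ _).trans ?_
  refine (Finset.sum_le_card_nsmul _ _ ε fun i hi => (hk _ _ fun j hj => ?_).le).trans ?_
  · rw [shift_iterate_apply, shift_iterate_apply]
    exact hxy _ (by have := Finset.mem_range.1 hi; omega)
  · simp

/-- Entropy lower bound obtained by testing against Birkhoff sums of `u` with `L_g (e^u) = 1`. -/
lemma mul_integral_le_relEntN {p : Measure A} {g u : (ℕ → A) → ℝ} (hu : Continuous u)
    (hone : ∀ x, ruelle p g (fun y => Real.exp (u y)) x = 1)
    (ν : Measure (ℕ → A)) [IsProbabilityMeasure ν]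
    (hfix : ∀ φ : (ℕ → A) → ℝ, Continuous φ → ∫ x, ruelle p g φ x ∂ν = ∫ x, φ x ∂ν)
    (μ : Measure (ℕ → A)) [IsProbabilityMeasure μ] (hinv : μ.map shift = μ)
    {ε : ℝ} {k : ℕ} (hk : ∀ x y : ℕ → A, (∀ i < k, x i = y i) → |u x - u y| < ε) (n : ℕ) :
    ((n * (∫ x, u x ∂μ - 2 * ε) : ℝ) : EReal) ≤ relEntN (n + k) μ ν := by
  obtain ⟨y⟩ : Nonempty (ℕ → A) := μ.nonempty_of_neZero
  have hp := continuous_proj (X := A) (n + k)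
  have hpm := hp.measurable
  set ψ : (Fin (n + k) → A) → ℝ := fun a => birkhoff n u (wordCons (n + k) a y) with hψ
  have hψc : Continuous ψ := (continuous_birkhoff hu n).comp (continuous_wordCons _ y)
  have hB := continuous_birkhoff hu n
  have hclose : ∀ x, |ψ (proj (n + k) x) - birkhoff n u x| ≤ n * ε := fun x =>
    abs_birkhoff_sub_le hk n _ _ fun i hi => wordCons_proj_apply hi x y
  have := Measure.isProbabilityMeasure_map (μ := μ) hpm.aemeasurable
  have := Measure.isProbabilityMeasure_map (μ := ν) hpm.aemeasurable
  have hexp := integrable_of_continuous hψc.rexp (ν.map (proj (n + k)))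
  refine le_trans ?_ (integral_sub_log_le_relEnt
    (integrable_of_continuous hψc _) hexp)
  have hlow : n * ∫ x, u x ∂μ - n * ε ≤ ∫ a, ψ a ∂(μ.map (proj (n + k))) := by
    rw [integral_map hpm.aemeasurable hψc.measurable.aestronglyMeasurable,
      ← integral_birkhoff hinv hu n]
    have hc : ∫ _, (n * ε : ℝ) ∂μ = n * ε := by simp
    rw [← hc, ← integral_sub (integrable_of_continuous hB μ) (integrable_const _)]
    refine integral_mono ((integrable_of_continuous hB μ).sub (integrable_const _))
      (integrable_of_continuous (hψc.comp hp) μ) fun x => ?_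
    have := (abs_le.1 (hclose x)).1
    simp only
    linarith
  have hup : ∫ a, Real.exp (ψ a) ∂(ν.map (proj (n + k))) ≤ Real.exp (n * ε) := by
    rw [integral_map hpm.aemeasurable hψc.rexp.measurable.aestronglyMeasurable]
    calc ∫ x, Real.exp (ψ (proj (n + k) x)) ∂ν
        ≤ ∫ x, Real.exp (n * ε) * Real.exp (birkhoff n u x) ∂ν := by
          refine integral_mono
            (integrable_of_continuous (hψc.comp hp).rexp ν)
            (integrable_of_continuous (continuous_const.mul hB.rexp) ν)
            fun x => ?_
          rw [← Real.exp_add]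
          have := (abs_le.1 (hclose x)).2
          exact Real.exp_le_exp.2 (by linarith)
      _ = Real.exp (n * ε) := by
          rw [integral_const_mul, integral_exp_birkhoff hu hone ν hfix n, mul_one]
  have hlog := Real.log_le_log (integral_exp_pos hexp) hup
  rw [Real.log_exp] at hlog
  exact EReal.coe_le_coe_iff.2 (by linarith)

lemma integral_nonpos_of_tendsto_relEntN {p : Measure A} {g u : (ℕ → A) → ℝ} (hu : Continuous u)
    (hone : ∀ x, ruelle p g (fun y => Real.exp (u y)) x = 1)
    (ν : Measure (ℕ → A)) [IsProbabilityMeasure ν]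
    (hfix : ∀ φ : (ℕ → A) → ℝ, Continuous φ → ∫ x, ruelle p g φ x ∂ν = ∫ x, φ x ∂ν)
    (μ : Measure (ℕ → A)) [IsProbabilityMeasure μ] (hinv : μ.map shift = μ)
    (hlim : Tendsto (fun n : ℕ => ((n : ℝ)⁻¹ : EReal) * relEntN n μ ν) atTop (nhds 0)) :
    ∫ x, u x ∂μ ≤ 0 := by
  refine le_of_forall_pos_le_add fun ε hε => ?_
  obtain ⟨k, hk⟩ := exists_dependsOn_approx hu (half_pos hε)
  set c : ℝ := ∫ x, u x ∂μ - 2 * (ε / 2) with hc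
  have hle : ∀ n : ℕ, ((((n + k : ℕ) : ℝ)⁻¹ * (n * c) : ℝ) : EReal)
      ≤ (((n + k : ℕ) : ℝ)⁻¹ : EReal) * relEntN (n + k) μ ν := by
    intro n
    rw [EReal.coe_mul, EReal.coe_inv]
    refine mul_le_mul_of_nonneg_left (mul_integral_le_relEntN hu hone ν hfix μ hinv hk n) ?_
    rw [← EReal.coe_inv]
    exact EReal.coe_nonneg.2 (by positivity)
  have hreal : Tendsto (fun n : ℕ => ((n + k : ℕ) : ℝ)⁻¹ * (n * c)) atTop (nhds c) := by
    have h1 := (tendsto_natCast_div_add_atTop (𝕜 := ℝ) (k : ℝ)).mul_const c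
    rw [one_mul] at h1
    refine h1.congr fun n => ?_
    push_cast
    ring
  have hE := (continuous_coe_real_ereal.tendsto c).comp hreal
  have h0 := le_of_tendsto_of_tendsto' hE (hlim.comp (tendsto_add_atTop_nat k)) hle
  have : c ≤ 0 := by exact_mod_cast h0
  linarith

lemma integral_le_integral_log_ruelle_exp {p : Measure A} [IsProbabilityMeasure p]
    {g φ : (ℕ → A) → ℝ} (hg : Continuous g) (hφ : Continuous φ)
    (ν : Measure (ℕ → A)) [IsProbabilityMeasure ν]
    (hfix : ∀ φ : (ℕ → A) → ℝ, Continuous φ → ∫ x, ruelle p g φ x ∂ν = ∫ x, φ x ∂ν)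
    (μ : Measure (ℕ → A)) [IsProbabilityMeasure μ] (hinv : μ.map shift = μ)
    (hlim : Tendsto (fun n : ℕ => ((n : ℝ)⁻¹ : EReal) * relEntN n μ ν) atTop (nhds 0)) :
    ∫ x, φ x ∂μ ≤ ∫ x, Real.log (ruelle p g (fun y => Real.exp (φ y)) x) ∂μ := by
  set w := ruelle p g (fun y => Real.exp (φ y)) with hw
  have hwpos : ∀ x, 0 < w x := ruelle_exp_pos hg hφ
  have hlog : Continuous fun x => Real.log (w x) :=
    (continuous_ruelle p hg hφ.rexp).log fun x => (hwpos x).ne'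
  have hlogs : Continuous fun x => Real.log (w (shift x)) := hlog.comp continuous_shift
  have hone : ∀ x, ruelle p g (fun y => Real.exp (φ y - Real.log (w (shift y)))) x = 1 := by
    intro x
    have hmul := ruelle_mul_comp_shift p g (fun y => Real.exp (φ y)) (fun y => (w y)⁻¹) x
    rw [← hw, mul_inv_cancel₀ (hwpos x).ne'] at hmul
    simpa only [Real.exp_sub, Real.exp_log (hwpos _), div_eq_mul_inv] using hmul
  have hneg := integral_nonpos_of_tendsto_relEntN (hφ.sub hlogs) hone ν hfix μ hinv hlim
  simp only [Pi.sub_apply] at hneg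
  rw [integral_sub (integrable_of_continuous hφ μ)
    (integrable_of_continuous hlogs μ), integral_comp_shift hinv hlog] at hneg
  linarith

lemma integral_le_integral_ruelle {p : Measure A} [IsProbabilityMeasure p]
    {g φ : (ℕ → A) → ℝ} (hg : Continuous g) (hg1 : ∀ x, ruelle p g (fun _ => 1) x = 1)
    (hφ : Continuous φ) (ν : Measure (ℕ → A)) [IsProbabilityMeasure ν]
    (hfix : ∀ φ : (ℕ → A) → ℝ, Continuous φ → ∫ x, ruelle p g φ x ∂ν = ∫ x, φ x ∂ν)
    (μ : Measure (ℕ → A)) [IsProbabilityMeasure μ] (hinv : μ.map shift = μ)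
    (hlim : Tendsto (fun n : ℕ => ((n : ℝ)⁻¹ : EReal) * relEntN n μ ν) atTop (nhds 0)) :
    ∫ x, φ x ∂μ ≤ ∫ x, ruelle p g φ x ∂μ := by
  obtain ⟨M, hM⟩ := (isCompact_univ (X := ℕ → A)).exists_bound_of_continuousOn hφ.continuousOn
  set K : ℝ := max M 1 with hK
  have hK1 : 1 ≤ K := le_max_right _ _
  have hφK : ∀ x, |φ x| ≤ K := fun x => (hM x trivial).trans (le_max_left _ _)
  have hmain : ∀ t : ℝ, 0 < t → t * K ≤ 1 →
      ∫ x, φ x ∂μ ≤ ∫ x, ruelle p g φ x ∂μ + t * K ^ 2 := by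
    intro t ht htK
    have hRc := continuous_ruelle p hg hφ
    have htφ : Continuous fun x => t * φ x := continuous_const.mul hφ
    have hexp : ∀ y, Real.exp (t * φ y) ≤ 1 + t * φ y + t ^ 2 * K ^ 2 := by
      intro y
      have habs : |t * φ y| ≤ t * K := by
        rw [abs_mul, abs_of_pos ht]
        exact mul_le_mul_of_nonneg_left (hφK y) ht.le
      have h1 := (abs_le.1 (Real.abs_exp_sub_one_sub_id_le (habs.trans htK))).2
      have h2 : (t * φ y) ^ 2 ≤ (t * K) ^ 2 := sq_le_sq' (abs_le.1 habs).1 (abs_le.1 habs).2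
      linarith [mul_pow t K 2]
    have hbound : ∀ x, Real.log (ruelle p g (fun y => Real.exp (t * φ y)) x)
        ≤ t * ruelle p g φ x + t ^ 2 * K ^ 2 := by
      intro x
      refine (Real.log_le_sub_one_of_pos (ruelle_exp_pos hg htφ x)).trans ?_
      have h1 := integrable_ruelle p hg (φ := fun _ => 1) continuous_const x
      have h2 := integrable_ruelle p hg hφ x
      have hle : ruelle p g (fun y => Real.exp (t * φ y)) x
          ≤ ∫ a, ((1 + t ^ 2 * K ^ 2) * (Real.exp (g (cons a x)) * 1)
            + t * (Real.exp (g (cons a x)) * φ (cons a x))) ∂p := by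
        refine integral_mono (integrable_ruelle p hg htφ.rexp x)
          ((h1.const_mul _).add (h2.const_mul _)) fun a => ?_
        have := mul_le_mul_of_nonneg_left (hexp (cons a x)) (Real.exp_pos (g (cons a x))).le
        simp only
        linarith
      rw [integral_add (h1.const_mul _) (h2.const_mul _), integral_const_mul,
        integral_const_mul] at hle
      have hg1x := hg1 x
      simp only [ruelle] at hle hg1x ⊢
      rw [hg1x] at hle
      linarith
    have hle := integral_le_integral_log_ruelle_exp hg htφ ν hfix μ hinv hlim
    have hlogc : Continuous fun x => Real.log (ruelle p g (fun y => Real.exp (t * φ y)) x) :=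
      (continuous_ruelle p hg htφ.rexp).log fun x => (ruelle_exp_pos hg htφ x).ne'
    have hRi := integrable_of_continuous hRc μ
    have hle2 := hle.trans (integral_mono (integrable_of_continuous hlogc μ)
      ((hRi.const_mul t).add (integrable_const (t ^ 2 * K ^ 2))) hbound)
    simp only [Pi.add_apply] at hle2
    rw [integral_add (hRi.const_mul t) (integrable_const _), integral_const_mul,
      integral_const_mul, integral_const, probReal_univ, one_smul] at hle2
    refine le_of_mul_le_mul_left ?_ ht
    linarith
  have hK0 : 0 < K := by linarith
  refine le_of_forall_pos_le_add fun ε hε => ?_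
  have hpos : 0 < min (1 / K) (ε / K ^ 2) := by positivity
  refine (hmain _ hpos ?_).trans ?_
  · exact (le_div_iff₀ hK0).1 (min_le_left _ _)
  · have := (le_div_iff₀ (by positivity)).1 (min_le_right (1 / K) (ε / K ^ 2))
    linarith

/-- Vanishing specific relative entropy forces a shift-invariant measure to be fixed by `L_g*`. -/
lemma integral_ruelle_eq_of_tendsto_relEntN {p : Measure A} [IsProbabilityMeasure p]
    {g φ : (ℕ → A) → ℝ} (hg : Continuous g) (hg1 : ∀ x, ruelle p g (fun _ => 1) x = 1)
    (hφ : Continuous φ) (ν : Measure (ℕ → A)) [IsProbabilityMeasure ν]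
    (hfix : ∀ φ : (ℕ → A) → ℝ, Continuous φ → ∫ x, ruelle p g φ x ∂ν = ∫ x, φ x ∂ν)
    (μ : Measure (ℕ → A)) [IsProbabilityMeasure μ] (hinv : μ.map shift = μ)
    (hlim : Tendsto (fun n : ℕ => ((n : ℝ)⁻¹ : EReal) * relEntN n μ ν) atTop (nhds 0)) :
    ∫ x, ruelle p g φ x ∂μ = ∫ x, φ x ∂μ := by
  refine le_antisymm ?_ (integral_le_integral_ruelle hg hg1 hφ ν hfix μ hinv hlim)
  have hneg := integral_le_integral_ruelle hg hg1 hφ.neg ν hfix μ hinv hlim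
  simp only [ruelle, Pi.neg_apply, mul_neg, integral_neg] at hneg ⊢
  linarith

lemma tendsto_relEntN_self (μ : Measure (ℕ → A)) [IsProbabilityMeasure μ] :
    Tendsto (fun n : ℕ => ((n : ℝ)⁻¹ : EReal) * relEntN n μ μ) atTop (nhds 0) := by
  have hz : ∀ n : ℕ, ((n : ℝ)⁻¹ : EReal) * relEntN n μ μ = 0 := by
    intro n
    have := Measure.isProbabilityMeasure_map (μ := μ)
      (continuous_proj (X := A) n).measurable.aemeasurable
    rw [relEntN, relEnt_self, mul_zero]
  simp only [hz, tendsto_const_nhds]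

/-- For an `α`-Hölder potential `f` with eigendata `(λ, h)`, `f̄` the
associated normalized potential and `μ_f̄` the unique Borel probability measure fixed by
the transpose of `L_{f̄}`, for a shift-invariant Borel probability measure `μ` we have
`lim_n (1/n) H_{Λ_n}(μ | μ_f̄) = 0` iff `L_{f̄}* μ = μ`, i.e. iff `μ = μ_f̄`. -/
theorem statement3
    (p : Measure A) [IsProbabilityMeasure p]
    (hsupp : ∀ U : Set A, IsOpen U → U.Nonempty → 0 < p U)
    (α : ℝ) (hα0 : 0 < α) (hα1 : α < 1)
    (f : (ℕ → A) → ℝ) (hf : IsHolder α f)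
    (lam : ℝ) (hlam : 0 < lam)
    (h : (ℕ → A) → ℝ) (hh : IsHolder α h) (hpos : ∀ x, 0 < h x)
    (heig : ∀ x, ruelle p f h x = lam * h x)
    (μf : Measure (ℕ → A)) [IsProbabilityMeasure μf]
    (hfix : ∀ φ : (ℕ → A) → ℝ, Continuous φ →
      ∫ x, ruelle p (fbar f h lam) φ x ∂μf = ∫ x, φ x ∂μf)
    (huniq : ∀ ν : Measure (ℕ → A), IsProbabilityMeasure ν →
      (∀ φ : (ℕ → A) → ℝ, Continuous φ →
        ∫ x, ruelle p (fbar f h lam) φ x ∂ν = ∫ x, φ x ∂ν) → ν = μf)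
    (μ : Measure (ℕ → A)) [IsProbabilityMeasure μ]
    (hinv : μ.map shift = μ) :
    (Tendsto (fun n : ℕ => ((n : ℝ)⁻¹ : EReal) * relEntN n μ μf) atTop (nhds 0)
      ↔ (∀ φ : (ℕ → A) → ℝ, Continuous φ →
          ∫ x, ruelle p (fbar f h lam) φ x ∂μ = ∫ x, φ x ∂μ))
    ∧ (Tendsto (fun n : ℕ => ((n : ℝ)⁻¹ : EReal) * relEntN n μ μf) atTop (nhds 0)
      ↔ μ = μf) := by
  have hg := continuous_fbar (hf.continuous hα0) (hh.continuous hα0) hpos lam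
  have hto : Tendsto (fun n : ℕ => ((n : ℝ)⁻¹ : EReal) * relEntN n μ μf) atTop (nhds 0) →
      ∀ φ : (ℕ → A) → ℝ, Continuous φ →
        ∫ x, ruelle p (fbar f h lam) φ x ∂μ = ∫ x, φ x ∂μ := fun hlim φ hφ =>
    integral_ruelle_eq_of_tendsto_relEntN hg (ruelle_fbar_one hlam hpos heig) hφ μf hfix μ hinv
      hlim
  have hback : μ = μf →
      Tendsto (fun n : ℕ => ((n : ℝ)⁻¹ : EReal) * relEntN n μ μf) atTop (nhds 0) := by
    rintro rfl
    exact tendsto_relEntN_self μ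
  exact ⟨⟨hto, fun hμ => hback (huniq μ inferInstance hμ)⟩,
    ⟨fun hlim => huniq μ inferInstance (hto hlim), hback⟩⟩

end Paper
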